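/- Let t be a node of the rooted tree decomposition (T, {X_t}) of D_{M,b} with exactly two children t_1, t_2 such that X_t = X_{t_1} = X_{t_2} and V_{t_1} ∩ V_{t_2} = X_t. Then for every b-monotone f : X_t → [n], T_t[f] = T_{t_1}[f] + T_{t_2}[f] − gain_M(f), i.e., T_t[f] = T_{t_1}[f] + T_{t_2}[f] − (w-sum of the removed-edge terms of f minus the w-sum of the added-edge terms of f), where the maxima are taken in ℤ ∪ {−∞} (value −∞ for an empty set). -/

import Mathlib

/-- The `i`-th edge of the reference tour `H` on `Fin n`: `{w_i, w_{i+1}}` (cyclically). -/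
def tourEdge (n : ℕ) (i : Fin n) : Sym2 (Fin n) :=
  s(i, ⟨(i.val + 1) % n, Nat.mod_lt _ (by have := i.isLt; omega)⟩)

/-- The endpoints `v_1, …, v_{2k}` (0-indexed: `v_{2j}` is the left endpoint of
`e_{f(j)}` and `v_{2j+1}` its right endpoint). -/
def endpointMap (n k : ℕ) (f : Fin k → Fin n) : Fin (2 * k) → Fin n :=
  fun p =>
    if p.val % 2 = 0 then f ⟨p.val / 2, by have := p.isLt; omega⟩
    else ⟨((f ⟨p.val / 2, by have := p.isLt; omega⟩).val + 1) % n,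
          Nat.mod_lt _ (by have := (f ⟨p.val / 2, by have := p.isLt; omega⟩).isLt; omega)⟩

/-- The index `⌈i'/2⌉ ∈ [k]` of a matching vertex `i' ∈ [2k]` (0-indexed: `v ↦ ⌊v/2⌋`). -/
def halfIdx (k : ℕ) (v : Fin (2 * k)) : Fin k :=
  ⟨v.val / 2, by have := v.isLt; omega⟩

/-- A perfect matching on the vertex set `V`, given by its edge set. -/
def IsPerfectMatchingEdgeSet {V : Type*} (M : Set (Sym2 V)) : Prop :=
  (∀ e ∈ M, ¬ e.IsDiag) ∧ ∀ v : V, ∃! e, e ∈ M ∧ v ∈ e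

/-- The identification pairs for validity: (1-indexed) `2i ~ (2i+1) mod 2k`. -/
def nuEdges (k : ℕ) : Set (Sym2 (Fin (2 * k))) :=
  { e | ∃ j : Fin k,
      e = s((⟨(2 * j.val + 1) % (2 * k), Nat.mod_lt _ (by have := j.isLt; omega)⟩ : Fin (2 * k)),
            (⟨(2 * j.val + 2) % (2 * k), Nat.mod_lt _ (by have := j.isLt; omega)⟩ : Fin (2 * k))) }

/-- A valid connection `k`-pattern. -/
def IsValidPattern (k : ℕ) (M : Set (Sym2 (Fin (2 * k)))) : Prop :=
  IsPerfectMatchingEdgeSet M ∧ (SimpleGraph.fromEdgeSet (M ∪ nuEdges k)).Connected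

/-- `I_M`: the edge set on `[k]` obtained from `M` by identifying `2i-1, 2i ↦ i`. -/
def IM (k : ℕ) (M : Set (Sym2 (Fin (2 * k)))) : Set (Sym2 (Fin k)) :=
  { e | ¬ e.IsDiag ∧ ∃ e' ∈ M, Sym2.map (halfIdx k) e' = e }

/-- `O_b = {{i, i+1} : b i = b (i+1)}`, the order dependencies. -/
def Ob (k nb : ℕ) (b : Fin k → Fin nb) : Set (Sym2 (Fin k)) :=
  { e | ∃ (i : ℕ) (h : i + 1 < k),
      b ⟨i, by omega⟩ = b ⟨i + 1, h⟩ ∧ e = s((⟨i, by omega⟩ : Fin k), (⟨i + 1, h⟩ : Fin k)) }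

/-- `f` is a `b`-monotone partial embedding with domain `S` (values outside `S`
are irrelevant): (M1) `bo (f i) = b i` on `S`; (M2) `f i < f (i+1)` whenever
`{i, i+1} ∈ O_b` and `i, i+1 ∈ S`. -/
def BMonotoneOn (n k nb : ℕ) (bo : Fin n → Fin nb) (b : Fin k → Fin nb)
    (S : Set (Fin k)) (f : Fin k → Fin n) : Prop :=
  (∀ i ∈ S, bo (f i) = b i) ∧
  (∀ (i : ℕ) (h : i + 1 < k), (⟨i, by omega⟩ : Fin k) ∈ S → (⟨i + 1, h⟩ : Fin k) ∈ S →
    b ⟨i, by omega⟩ = b ⟨i + 1, h⟩ → f ⟨i, by omega⟩ < f ⟨i + 1, h⟩)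

/-- The `M`-gain of the partial embedding `f` with domain `S`: the total weight of
the removed edges `e_{f j}`, `j ∈ S`, minus the total weight of the added edges,
i.e. of the edges `{v_{i'}, v_{j'}}` over all pairs `{i', j'} ∈ M` both of whose
endpoint indices lie (after halving) in `S` (summed with multiplicity over the
pairs of `M`). -/
noncomputable def gainM (n k : ℕ) (w : Sym2 (Fin n) → ℤ) (M : Set (Sym2 (Fin (2 * k))))
    (S : Set (Fin k)) (f : Fin k → Fin n) : ℤ :=
  (∑ᶠ j ∈ S, w (tourEdge n (f j))) -
    ∑ᶠ e ∈ { e' : Sym2 (Fin (2 * k)) | e' ∈ M ∧ ∀ v ∈ e', halfIdx k v ∈ S },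
      w (Sym2.map (endpointMap n k f) e)

/-- `(T, X)` is a tree decomposition of the graph `G`. -/
def TreeDecompOf {V ι : Type} (G : SimpleGraph V) (T : SimpleGraph ι)
    (X : ι → Finset V) : Prop :=
  T.IsTree ∧ (∀ v, ∃ t, v ∈ X t) ∧
    (∀ e ∈ G.edgeSet, ∃ t, ∀ v ∈ e, v ∈ X t) ∧
    (∀ v : V, (T.induce { t | v ∈ X t }).Connected)

/-- The set of nodes in the subtree rooted at `t` of the tree `T` rooted at `r`:
those nodes all of whose walks to the root pass through `t`. -/
def descend {ι : Type} (T : SimpleGraph ι) (r t : ι) : Set ι :=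
  { s | ∀ p : T.Walk s r, t ∈ p.support }

/-- `V_t`: the union of the bags in the subtree rooted at `t`. -/
def Vt {V ι : Type} (T : SimpleGraph ι) (X : ι → Finset V) (r t : ι) : Set V :=
  { v | ∃ s ∈ descend T r t, v ∈ X s }

/-- The dynamic-programming table: `T_t[f]` is the maximum (in `ℤ ∪ {−∞}`,
realized as `EReal`, with `sSup ∅ = ⊥`) of `gain_M(g)` over all `b`-monotone
`g : V_t → [n]` with `g|_{X_t} = f`. -/
noncomputable def Ttab (n k nb : ℕ) (w : Sym2 (Fin n) → ℤ) (M : Set (Sym2 (Fin (2 * k))))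
    (bo : Fin n → Fin nb) (b : Fin k → Fin nb) {ι : Type} (T : SimpleGraph ι)
    (X : ι → Finset (Fin k)) (r t : ι) (f : Fin k → Fin n) : EReal :=
  sSup { x : EReal | ∃ g : Fin k → Fin n,
    BMonotoneOn n k nb bo b (Vt T X r t) g ∧ (∀ j ∈ X t, g j = f j) ∧
    x = ((gainM n k w M (Vt T X r t) g : ℝ) : EReal) }

theorem endpointMap_congr {n k : ℕ} {f g : Fin k → Fin n} {p : Fin (2 * k)}
    (h : f (halfIdx k p) = g (halfIdx k p)) : endpointMap n k f p = endpointMap n k g p := by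
  unfold halfIdx at h
  simp only [endpointMap, h]

theorem gainM_congr {n k : ℕ} (w : Sym2 (Fin n) → ℤ) (M : Set (Sym2 (Fin (2 * k))))
    {S : Set (Fin k)} {f g : Fin k → Fin n} (h : ∀ j ∈ S, f j = g j) :
    gainM n k w M S f = gainM n k w M S g := by
  unfold gainM
  congr 1
  · exact finsum_mem_congr rfl fun j hj => by rw [h j hj]
  · refine finsum_mem_congr rfl fun e he => ?_
    rw [Sym2.map_congr fun v hv => endpointMap_congr (h _ (he.2 v hv))]

theorem BMonotoneOn.congr {n k nb : ℕ} {bo : Fin n → Fin nb} {b : Fin k → Fin nb}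
    {S : Set (Fin k)} {f g : Fin k → Fin n} (hf : BMonotoneOn n k nb bo b S f)
    (h : ∀ j ∈ S, f j = g j) : BMonotoneOn n k nb bo b S g := by
  refine ⟨fun i hi => h i hi ▸ hf.1 i hi, fun i hi h₁ h₂ hb => ?_⟩
  rw [← h _ h₁, ← h _ h₂]
  exact hf.2 i hi h₁ h₂ hb

theorem BMonotoneOn.mono {n k nb : ℕ} {bo : Fin n → Fin nb} {b : Fin k → Fin nb}
    {S S' : Set (Fin k)} {f : Fin k → Fin n} (hf : BMonotoneOn n k nb bo b S f)
    (h : S' ⊆ S) : BMonotoneOn n k nb bo b S' f :=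
  ⟨fun i hi => hf.1 i (h hi), fun i hi h₁ h₂ => hf.2 i hi (h h₁) (h h₂)⟩

/-- No element of `E` inside `S₁ ∪ S₂` crosses between `S₁ \ S₂` and `S₂ \ S₁`. -/
def NonCrossing {V : Type*} (E : Set (Sym2 V)) (S₁ S₂ : Set V) : Prop :=
  ∀ e ∈ E, (∀ v ∈ e, v ∈ S₁ ∪ S₂) → (∀ v ∈ e, v ∈ S₁) ∨ (∀ v ∈ e, v ∈ S₂)

theorem BMonotoneOn.union {n k nb : ℕ} {bo : Fin n → Fin nb} {b : Fin k → Fin nb}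
    {S₁ S₂ : Set (Fin k)} {f : Fin k → Fin n} (h₁ : BMonotoneOn n k nb bo b S₁ f)
    (h₂ : BMonotoneOn n k nb bo b S₂ f) (hO : NonCrossing (Ob k nb b) S₁ S₂) :
    BMonotoneOn n k nb bo b (S₁ ∪ S₂) f := by
  refine ⟨fun i hi => hi.elim (h₁.1 i) (h₂.1 i), fun i hi hl hr hb => ?_⟩
  rcases hO _ ⟨i, hi, hb, rfl⟩ (by simp only [Sym2.mem_iff]; rintro v (rfl | rfl) <;> assumption)
    with h | h
  · exact h₁.2 i hi (h _ (Sym2.mem_mk_left _ _)) (h _ (Sym2.mem_mk_right _ _)) hb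
  · exact h₂.2 i hi (h _ (Sym2.mem_mk_left _ _)) (h _ (Sym2.mem_mk_right _ _)) hb

theorem gainM_union_add_inter {n k : ℕ} (w : Sym2 (Fin n) → ℤ) {M : Set (Sym2 (Fin (2 * k)))}
    {S₁ S₂ : Set (Fin k)} (hI : NonCrossing (IM k M) S₁ S₂) (g : Fin k → Fin n) :
    gainM n k w M (S₁ ∪ S₂) g + gainM n k w M (S₁ ∩ S₂) g =
      gainM n k w M S₁ g + gainM n k w M S₂ g := by
  have hU : { e : Sym2 (Fin (2 * k)) | e ∈ M ∧ ∀ v ∈ e, halfIdx k v ∈ S₁ ∪ S₂ } =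
      { e | e ∈ M ∧ ∀ v ∈ e, halfIdx k v ∈ S₁ } ∪ { e | e ∈ M ∧ ∀ v ∈ e, halfIdx k v ∈ S₂ } := by
    ext e
    constructor
    · rintro ⟨heM, he⟩
      by_cases hd : (Sym2.map (halfIdx k) e).IsDiag
      · induction e using Sym2.ind with
        | _ x y =>
          simp only [Sym2.map_mk, Sym2.mk_isDiag_iff] at hd
          rcases he x (Sym2.mem_mk_left _ _) with h | h
          · refine Or.inl ⟨heM, fun v hv => ?_⟩
            rcases Sym2.mem_iff.1 hv with rfl | rfl
            exacts [h, hd ▸ h]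
          · refine Or.inr ⟨heM, fun v hv => ?_⟩
            rcases Sym2.mem_iff.1 hv with rfl | rfl
            exacts [h, hd ▸ h]
      · have hmem : ∀ v ∈ Sym2.map (halfIdx k) e, v ∈ S₁ ∪ S₂ := by
          intro v hv
          obtain ⟨u, hu, rfl⟩ := Sym2.mem_map.1 hv
          exact he u hu
        rcases hI _ ⟨hd, e, heM, rfl⟩ hmem with h | h
        · exact Or.inl ⟨heM, fun v hv => h _ (Sym2.mem_map.2 ⟨v, hv, rfl⟩)⟩
        · exact Or.inr ⟨heM, fun v hv => h _ (Sym2.mem_map.2 ⟨v, hv, rfl⟩)⟩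
    · rintro (⟨heM, he⟩ | ⟨heM, he⟩)
      exacts [⟨heM, fun v hv => Or.inl (he v hv)⟩, ⟨heM, fun v hv => Or.inr (he v hv)⟩]
  have hN : { e : Sym2 (Fin (2 * k)) | e ∈ M ∧ ∀ v ∈ e, halfIdx k v ∈ S₁ ∩ S₂ } =
      { e | e ∈ M ∧ ∀ v ∈ e, halfIdx k v ∈ S₁ } ∩ { e | e ∈ M ∧ ∀ v ∈ e, halfIdx k v ∈ S₂ } := by
    ext e
    simp only [Set.mem_ofPred_eq, Set.mem_inter_iff]
    grind
  have hj := finsum_mem_union_inter (f := fun j => w (tourEdge n (g j)))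
    S₁.toFinite S₂.toFinite
  have he := finsum_mem_union_inter (f := fun e => w (Sym2.map (endpointMap n k g) e))
    (Set.toFinite { e : Sym2 (Fin (2 * k)) | e ∈ M ∧ ∀ v ∈ e, halfIdx k v ∈ S₁ })
    (Set.toFinite { e : Sym2 (Fin (2 * k)) | e ∈ M ∧ ∀ v ∈ e, halfIdx k v ∈ S₂ })
  rw [← hU, ← hN] at he
  unfold gainM
  linarith

theorem mem_descend_self {ι : Type} (T : SimpleGraph ι) (r t : ι) : t ∈ descend T r t :=
  fun p => p.start_mem_support

theorem descend_subset {ι : Type} {T : SimpleGraph ι} {r t s : ι} (hs : s ∈ descend T r t) :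
    descend T r s ⊆ descend T r t := by
  classical
  intro u hu p
  exact p.support_dropUntil_subset_support (hu p) (hs (p.dropUntil s (hu p)))

/-- In a tree, a proper descendant of `t` is a descendant of some child of `t`. -/
theorem exists_child_of_mem_descend {ι : Type} {T : SimpleGraph ι} (hT : T.IsTree) {r t s : ι}
    (hs : s ∈ descend T r t) (hst : s ≠ t) :
    ∃ c, T.Adj t c ∧ c ∈ descend T r t ∧ s ∈ descend T r c := by
  classical
  obtain ⟨p, hp, hpu⟩ := hT.existsUnique_path s r
  have ht := hs p
  let q := p.takeUntil t ht
  have hq : q.IsPath := hp.takeUntil ht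
  have hnil : ¬ q.Nil := SimpleGraph.Walk.not_nil_of_ne hst
  have hcq : q.penultimate ∈ q.support := q.getVert_mem_support _
  have hadj : T.Adj q.penultimate t := q.adj_penultimate hnil
  have hcp : q.penultimate ∈ p.support := p.support_takeUntil_subset_support ht hcq
  refine ⟨q.penultimate, hadj.symm, fun p' => ?_, fun p' => ?_⟩
  · have hmem := hs ((q.takeUntil _ hcq).append p')
    rcases (SimpleGraph.Walk.mem_support_append_iff _ _).1 hmem with h | h
    · exact absurd h (SimpleGraph.Walk.endpoint_notMem_support_takeUntil hq hcq hadj.ne')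
    · exact h
  · have := hpu _ p'.bypass_isPath
    exact p'.support_bypass_subset_support (this ▸ hcp)

/-- If `u` occurs below `t` but not in the bag of `t`, then all bags containing `u` are below
`t`. -/
theorem mem_descend_of_mem_bag {V ι : Type} {T : SimpleGraph ι} {X : ι → Finset V} {r t s : ι}
    {u : V} (hconn : (T.induce { s | u ∈ X s }).Connected) (hu : u ∈ Vt T X r t)
    (hut : u ∉ X t) (hus : u ∈ X s) : s ∈ descend T r t := by
  obtain ⟨s₀, hs₀, hus₀⟩ := hu
  intro p
  obtain ⟨q⟩ := hconn.preconnected ⟨s₀, hus₀⟩ ⟨s, hus⟩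
  let q' : T.Walk s₀ s := q.map (SimpleGraph.Embedding.induce _).toHom
  rcases (SimpleGraph.Walk.mem_support_append_iff _ _).1 (hs₀ (q'.append p)) with h | h
  · rw [show q'.support = _ from SimpleGraph.Walk.support_map .., List.mem_map] at h
    obtain ⟨x, -, rfl⟩ := h
    exact absurd x.2 hut
  · exact h

theorem nonCrossing_Vt {V ι : Type} {E : Set (Sym2 V)} {T : SimpleGraph ι} {X : ι → Finset V}
    (hE : ∀ e ∈ E, ¬ e.IsDiag) (hTD : TreeDecompOf (SimpleGraph.fromEdgeSet E) T X) {r t₁ t₂ : ι}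
    (hX₁ : (X t₁ : Set V) ⊆ Vt T X r t₂) : NonCrossing E (Vt T X r t₁) (Vt T X r t₂) := by
  intro e he hmem
  by_contra! hcon
  obtain ⟨⟨x, hx, hx₁⟩, y, hy, hy₂⟩ := hcon
  have hy₁ : y ∈ Vt T X r t₁ := (hmem y hy).resolve_right hy₂
  obtain ⟨s, hs⟩ := hTD.2.2.1 e (by
    rw [SimpleGraph.edgeSet_fromEdgeSet]
    exact ⟨he, hE e he⟩)
  exact hx₁ ⟨s, mem_descend_of_mem_bag (hTD.2.2.2 y) hy₁ (fun h => hy₂ (hX₁ h)) (hs y hy), hs x hx⟩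

theorem not_isDiag_of_mem_IM_union_Ob {k nb : ℕ} {M : Set (Sym2 (Fin (2 * k)))}
    {b : Fin k → Fin nb} {e : Sym2 (Fin k)} (he : e ∈ IM k M ∪ Ob k nb b) : ¬ e.IsDiag := by
  rcases he with he | ⟨i, hi, -, rfl⟩
  · exact he.1
  · simp

theorem Vt_eq_union_children {V ι : Type} {T : SimpleGraph ι} (hT : T.IsTree) {X : ι → Finset V}
    {r t t₁ t₂ : ι} (hdesc₁ : t₁ ∈ descend T r t) (hdesc₂ : t₂ ∈ descend T r t)
    (huniq : ∀ s, T.Adj t s → s ∈ descend T r t → s = t₁ ∨ s = t₂) (hX₁ : X t = X t₁) :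
    Vt T X r t = Vt T X r t₁ ∪ Vt T X r t₂ := by
  ext v
  constructor
  · rintro ⟨s, hs, hv⟩
    by_cases hst : s = t
    · subst hst
      exact Or.inl ⟨t₁, mem_descend_self T r t₁, hX₁ ▸ hv⟩
    · obtain ⟨c, hc, hct, hsc⟩ := exists_child_of_mem_descend hT hs hst
      rcases huniq c hc hct with rfl | rfl
      exacts [Or.inl ⟨s, hsc, hv⟩, Or.inr ⟨s, hsc, hv⟩]
  · rintro (⟨s, hs, hv⟩ | ⟨s, hs, hv⟩)
    exacts [⟨s, descend_subset hdesc₁ hs, hv⟩, ⟨s, descend_subset hdesc₂ hs, hv⟩]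

/-- The set of gains of the `b`-monotone maps on `S` extending `f` on `Z`. -/
def gainSet (n k nb : ℕ) (w : Sym2 (Fin n) → ℤ) (M : Set (Sym2 (Fin (2 * k))))
    (bo : Fin n → Fin nb) (b : Fin k → Fin nb) (Z S : Set (Fin k)) (f : Fin k → Fin n) : Set ℤ :=
  { m | ∃ g : Fin k → Fin n,
    BMonotoneOn n k nb bo b S g ∧ (∀ j ∈ Z, g j = f j) ∧ m = gainM n k w M S g }

theorem gainSet_finite {n k nb : ℕ} (w : Sym2 (Fin n) → ℤ) (M : Set (Sym2 (Fin (2 * k))))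
    (bo : Fin n → Fin nb) (b : Fin k → Fin nb) (Z S : Set (Fin k)) (f : Fin k → Fin n) :
    (gainSet n k nb w M bo b Z S f).Finite := by
  refine (Set.finite_range fun g : Fin k → Fin n => gainM n k w M S g).subset ?_
  rintro _ ⟨g, -, -, rfl⟩
  exact ⟨g, rfl⟩

theorem Ttab_eq_sSup_image {n k nb : ℕ} (w : Sym2 (Fin n) → ℤ) (M : Set (Sym2 (Fin (2 * k))))
    (bo : Fin n → Fin nb) (b : Fin k → Fin nb) {ι : Type} (T : SimpleGraph ι)
    (X : ι → Finset (Fin k)) (r t : ι) (f : Fin k → Fin n) :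
    Ttab n k nb w M bo b T X r t f =
      sSup ((fun m : ℤ => ((m : ℝ) : EReal)) ''
        gainSet n k nb w M bo b (X t) (Vt T X r t) f) := by
  unfold Ttab
  congr 1
  ext x
  constructor
  · rintro ⟨g, hg, hgf, rfl⟩
    exact ⟨_, ⟨g, hg, hgf, rfl⟩, rfl⟩
  · rintro ⟨_, ⟨g, hg, hgf, rfl⟩, rfl⟩
    exact ⟨g, hg, hgf, rfl⟩

theorem gainSet_union {n k nb : ℕ} (w : Sym2 (Fin n) → ℤ) {M : Set (Sym2 (Fin (2 * k)))}
    (bo : Fin n → Fin nb) {b : Fin k → Fin nb} {S₁ S₂ : Set (Fin k)}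
    (hI : NonCrossing (IM k M) S₁ S₂) (hO : NonCrossing (Ob k nb b) S₁ S₂) (f : Fin k → Fin n) :
    gainSet n k nb w M bo b (S₁ ∩ S₂) (S₁ ∪ S₂) f =
      { m | ∃ a₁ ∈ gainSet n k nb w M bo b (S₁ ∩ S₂) S₁ f,
        ∃ a₂ ∈ gainSet n k nb w M bo b (S₁ ∩ S₂) S₂ f,
          m = a₁ + a₂ - gainM n k w M (S₁ ∩ S₂) f } := by
  classical
  ext m
  constructor
  · rintro ⟨g, hg, hgf, rfl⟩
    refine ⟨_, ⟨g, hg.mono Set.subset_union_left, hgf, rfl⟩,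
      _, ⟨g, hg.mono Set.subset_union_right, hgf, rfl⟩, ?_⟩
    rw [← gainM_congr w M hgf, ← gainM_union_add_inter w hI]
    ring
  · rintro ⟨_, ⟨g₁, hg₁, hgf₁, rfl⟩, _, ⟨g₂, hg₂, hgf₂, rfl⟩, rfl⟩
    let g : Fin k → Fin n := fun j => if j ∈ S₁ then g₁ j else g₂ j
    have hgg₁ : ∀ j ∈ S₁, g₁ j = g j := fun j hj => (if_pos hj).symm
    have hgg₂ : ∀ j ∈ S₂, g₂ j = g j := by
      intro j hj
      by_cases hj₁ : j ∈ S₁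
      · rw [← hgg₁ j hj₁, hgf₁ j ⟨hj₁, hj⟩, hgf₂ j ⟨hj₁, hj⟩]
      · exact (if_neg hj₁).symm
    have hgf : ∀ j ∈ S₁ ∩ S₂, g j = f j := fun j hj => (hgg₁ j hj.1).symm.trans (hgf₁ j hj)
    refine ⟨g, (hg₁.congr hgg₁).union (hg₂.congr hgg₂) hO, hgf, ?_⟩
    rw [← gainM_congr w M hgf, gainM_congr w M hgg₁, gainM_congr w M hgg₂,
      ← gainM_union_add_inter w hI]
    ring

/-- Maxima (in `ℤ ∪ {−∞}`) of finite sets of integers add up under translated sumsets. -/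
theorem sSup_image_add_sub {A₁ A₂ : Set ℤ} (h₁ : A₁.Finite) (h₂ : A₂.Finite) (c : ℤ) :
    sSup ((fun m : ℤ => ((m : ℝ) : EReal)) '' { m | ∃ a₁ ∈ A₁, ∃ a₂ ∈ A₂, m = a₁ + a₂ - c }) =
      sSup ((fun m : ℤ => ((m : ℝ) : EReal)) '' A₁) +
        sSup ((fun m : ℤ => ((m : ℝ) : EReal)) '' A₂) - ((c : ℝ) : EReal) := by
  rcases A₁.eq_empty_or_nonempty with rfl | hn₁
  · simp
  rcases A₂.eq_empty_or_nonempty with rfl | hn₂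
  · simp
  have hmono : Monotone fun m : ℤ => ((m : ℝ) : EReal) := fun a b hab => by
    simpa using hab
  have key : ∀ {A : Set ℤ} {a : ℤ}, IsGreatest A a →
      sSup ((fun m : ℤ => ((m : ℝ) : EReal)) '' A) = ((a : ℝ) : EReal) := fun h =>
    (hmono.map_isGreatest h).csSup_eq
  obtain ⟨a₁, ha₁⟩ : ∃ a, IsGreatest A₁ a := Set.exists_max_image A₁ id h₁ hn₁
  obtain ⟨a₂, ha₂⟩ : ∃ a, IsGreatest A₂ a := Set.exists_max_image A₂ id h₂ hn₂
  have ha : IsGreatest { m | ∃ a₁ ∈ A₁, ∃ a₂ ∈ A₂, m = a₁ + a₂ - c } (a₁ + a₂ - c) := by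
    refine ⟨⟨a₁, ha₁.1, a₂, ha₂.1, rfl⟩, ?_⟩
    rintro _ ⟨x, hx, y, hy, rfl⟩
    have := ha₁.2 hx
    have := ha₂.2 hy
    lia
  rw [key ha₁, key ha₂, key ha]
  push_cast
  rfl

/-- join node.  Let `t` be a node of the rooted tree
decomposition of `D_{M,b}` with exactly two children `t₁, t₂` such that
`X_t = X_{t₁} = X_{t₂}` and `V_{t₁} ∩ V_{t₂} = X_t`.  Then for every `b`-monotone
`f : X_t → [n]`, `T_t[f] = T_{t₁}[f] + T_{t₂}[f] − gain_M(f)` (maxima in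
`ℤ ∪ {−∞}`). -/
theorem stmt_10 (n k nb : ℕ) (hn : 0 < n) (hk : 2 ≤ k)
    (w : Sym2 (Fin n) → ℤ)
    (M : Set (Sym2 (Fin (2 * k)))) (hM : IsValidPattern k M)
    (bo : Fin n → Fin nb) (hbo : Monotone bo) (hbos : Function.Surjective bo)
    (b : Fin k → Fin nb) (hb : Monotone b)
    (ι : Type) (T : SimpleGraph ι) (X : ι → Finset (Fin k))
    (hTD : TreeDecompOf (SimpleGraph.fromEdgeSet (IM k M ∪ Ob k nb b)) T X)
    (r t t₁ t₂ : ι) (h12 : t₁ ≠ t₂)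
    (hadj₁ : T.Adj t t₁) (hdesc₁ : t₁ ∈ descend T r t)
    (hadj₂ : T.Adj t t₂) (hdesc₂ : t₂ ∈ descend T r t)
    (huniq : ∀ s, T.Adj t s → s ∈ descend T r t → s = t₁ ∨ s = t₂)
    (hX₁ : X t = X t₁) (hX₂ : X t = X t₂)
    (hV : Vt T X r t₁ ∩ Vt T X r t₂ = ↑(X t))
    (f : Fin k → Fin n) (hf : BMonotoneOn n k nb bo b (↑(X t)) f) :
    Ttab n k nb w M bo b T X r t f =
      Ttab n k nb w M bo b T X r t₁ f + Ttab n k nb w M bo b T X r t₂ f -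
        ((gainM n k w M (↑(X t)) f : ℝ) : EReal) := by
  have hN := nonCrossing_Vt (r := r) (t₁ := t₁) (t₂ := t₂)
    (fun e he => not_isDiag_of_mem_IM_union_Ob he) hTD (by
      rw [← hX₁, ← hV]
      exact Set.inter_subset_right)
  rw [Ttab_eq_sSup_image, Ttab_eq_sSup_image, Ttab_eq_sSup_image, ← hX₁, ← hX₂,
    Vt_eq_union_children hTD.1 hdesc₁ hdesc₂ huniq hX₁, ← hV,
    gainSet_union w bo (fun e he => hN e (Or.inl he)) (fun e he => hN e (Or.inr he)) f]
  exact sSup_image_add_sub (gainSet_finite ..) (gainSet_finite ..) _
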